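/- Let M be a finite fair Kripke structure whose states are valuations of a set of state variables V, and let V_i ⊆ V be a set of transition input variables that are irrelevant for fairness. Let M̂ be the liveness-to-safety transformation of M and let M̃ be the variant of M̂ in which the loop-detection constraints (the saving constraint l_s' ⇒ v̄' = v / ¬l_s' ⇒ v̄' = v̄ and the closing invariant LoopClosed ⇒ v = v̄) are restricted to the variables in V ∖ V_i. Then a reachable state ŝ with LoopClosed(ŝ) true exists in M̂ if and only if one exists in M̃. -/

import Mathlib

namespace BMC

variable {AP S : Type}

/-- A Kripke structure over state space `S` and atomic propositions `AP`. -/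
structure Kripke (S AP : Type) where
  T : S → S → Prop
  I : S → Prop
  L : S → Set AP

/-- The transition relation is total. -/
def Kripke.Total (M : Kripke S AP) : Prop := ∀ s, ∃ s', M.T s s'

/-- An initialised infinite path of `M`. -/
def Kripke.InitPath (M : Kripke S AP) (π : ℕ → S) : Prop :=
  M.I (π 0) ∧ ∀ i, M.T (π i) (π (i + 1))

/-- `π` is a (k,l)-loop. -/
def IsKLoop (π : ℕ → S) (k l : ℕ) : Prop :=
  0 < l ∧ l ≤ k ∧ π (l - 1) = π k ∧ ∀ i, l ≤ i → π (i + (k + 1 - l)) = π i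

/-- A fair Kripke structure with acceptance sets `F_0, …, F_f`. -/
structure FairKripke (S AP : Type) (f : ℕ) extends Kripke S AP where
  F : Fin (f + 1) → Set S

/-- A path is fair iff it visits each acceptance set infinitely often. -/
def FairKripke.FairPath {f : ℕ} (M : FairKripke S AP f) (π : ℕ → S) : Prop :=
  ∀ m : Fin (f + 1), ∀ N : ℕ, ∃ i, N ≤ i ∧ π i ∈ M.F m

end BMC
structure L2SState (S : Type) (f : ℕ) where
  v : S
  vbar : S
  ls : Prop
  inLoop : Prop
  loopClosed : Prop
  acc : Fin (f + 1) → Prop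

namespace BMC

variable {V : Type} {R : V → Type} {AP : Type} {f : ℕ}

/-- Agreement of two valuations of the state variables on the set `W`. -/
def EqOn (W : Set V) (x y : ∀ v, R v) : Prop := ∀ w ∈ W, x w = y w

/-- State invariants of the liveness-to-safety transformation, with the
loop-closing comparison `LoopClosed ⇒ v = v̄` restricted to the variables
in `W`. -/
def L2SInvW (W : Set V) (x : L2SState (∀ v, R v) f) : Prop :=
  (x.loopClosed → x.inLoop) ∧
  (x.loopClosed → EqOn W x.v x.vbar) ∧
  (∀ m, x.loopClosed → x.acc m)

/-- Initial states of the transformation. -/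
def L2SInitW (M : FairKripke (∀ v, R v) AP f) (W : Set V)
    (x : L2SState (∀ v, R v) f) : Prop :=
  L2SInvW W x ∧ M.I x.v ∧ ¬ x.ls ∧ ¬ x.inLoop ∧ ∀ m, ¬ x.acc m

/-- Transitions of the transformation, with the saving constraints
`l_s' ⇒ v̄' = v` and `¬l_s' ⇒ v̄' = v̄` restricted to the variables in `W`. -/
def L2STransW (M : FairKripke (∀ v, R v) AP f) (W : Set V)
    (x y : L2SState (∀ v, R v) f) : Prop :=
  L2SInvW W x ∧ L2SInvW W y ∧
  M.T x.v y.v ∧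
  (y.inLoop ↔ (x.inLoop ∨ y.ls)) ∧
  (x.inLoop → ¬ y.ls) ∧
  (y.ls → EqOn W y.vbar x.v) ∧ (¬ y.ls → EqOn W y.vbar x.vbar) ∧
  (∀ m, y.acc m ↔ (x.acc m ∨ (y.inLoop ∧ y.v ∈ M.F m)))

/-- Reachability in the transformation with tracked variable set `W`. -/
def L2SReachW (M : FairKripke (∀ v, R v) AP f) (W : Set V)
    (x : L2SState (∀ v, R v) f) : Prop :=
  ∃ (n : ℕ) (σ : ℕ → L2SState (∀ v, R v) f),
    L2SInitW M W (σ 0) ∧ (∀ i, i < n → L2STransW M W (σ i) (σ (i + 1))) ∧ σ n = x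

/-- `v0` is a transition input variable of `M`: its next-state value is not
constrained by the current state and the values of the other variables. -/
def TransitionInput (M : FairKripke (∀ v, R v) AP f) (v0 : V) : Prop :=
  ∀ x y y' : ∀ v, R v, M.T x y → (∀ w, w ≠ v0 → y' w = y w) → M.T x y'

/-- `v0` is irrelevant for fairness: membership in every acceptance set does
not depend on the value of `v0`. -/
def FairnessIrrelevant (M : FairKripke (∀ v, R v) AP f) (v0 : V) : Prop :=
  ∀ (m : Fin (f + 1)) (x x' : ∀ v, R v),
    (∀ w, w ≠ v0 → x' w = x w) → (x ∈ M.F m ↔ x' ∈ M.F m)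

end BMC

namespace BMC

theorem l2s_inv_of_single {V : Type} {R : V → Type} [Finite V] (Vi : Set V)
    (P : (∀ v, R v) → Prop)
    (h : ∀ v0 ∈ Vi, ∀ y y' : ∀ v, R v, (∀ w, w ≠ v0 → y' w = y w) → P y → P y')
    (y y' : ∀ v, R v) (hy : EqOn Viᶜ y' y) (hP : P y) : P y' := by
  classical
  have key : ∀ A : Finset V, (∀ a ∈ A, a ∈ Vi) →
      P (fun w => if w ∈ A then y' w else y w) := by
    intro A
    induction A using Finset.induction_on with
    | empty => intro _; simpa using hP
    | insert a A ha ih =>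
      intro hA
      refine h a (hA a (Finset.mem_insert_self a A)) _ _ ?_
        (ih fun b hb => hA b (Finset.mem_insert_of_mem hb))
      intro w hw
      simp [Finset.mem_insert, hw]
  have hfin : Vi.Finite := Set.toFinite Vi
  have := key hfin.toFinset (by simp)
  convert this using 1
  funext w
  by_cases hw : w ∈ Vi
  · simp [hw]
  · simp [hw, hy w hw]

theorem l2s_save {V : Type} {R : V → Type} {AP : Type} {f : ℕ}
    (M : FairKripke (∀ v, R v) AP f) (W : Set V) (n : ℕ)
    (σ : ℕ → L2SState (∀ v, R v) f) (h0 : L2SInitW M W (σ 0))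
    (hs : ∀ i, i < n → L2STransW M W (σ i) (σ (i + 1))) :
    ∀ i, i ≤ n →
      ((σ i).inLoop → ∃ k, k < i ∧ EqOn W (σ i).vbar (σ k).v ∧
        ∀ j, j < i → (σ (j + 1)).ls → j = k) ∧
      (¬ (σ i).inLoop → ∀ j, j < i → ¬ (σ (j + 1)).ls) := by
  intro i
  induction i with
  | zero => intro _; exact ⟨fun h => absurd h h0.2.2.2.1, fun _ j hj => by omega⟩
  | succ i ih =>
    intro hi
    obtain ⟨ih1, ih2⟩ := ih (by omega)
    obtain ⟨-, -, -, hl, hn, hsv, hk, -⟩ := hs i (by omega)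
    constructor
    · intro hin
      by_cases hx : (σ i).inLoop
      · obtain ⟨k, hki, he, hu⟩ := ih1 hx
        refine ⟨k, by omega, fun w hw => (hk (hn hx) w hw).trans (he w hw), ?_⟩
        intro j hj hjl
        rcases Nat.lt_succ_iff_lt_or_eq.mp hj with h | h
        · exact hu j h hjl
        · subst h; exact absurd hjl (hn hx)
      · have hls : (σ (i + 1)).ls := (hl.mp hin).resolve_left hx
        refine ⟨i, by omega, hsv hls, ?_⟩
        intro j hj hjl
        rcases Nat.lt_succ_iff_lt_or_eq.mp hj with h | h
        · exact absurd hjl (ih2 hx j h)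
        · exact h
    · intro hin j hj hjl
      rcases Nat.lt_succ_iff_lt_or_eq.mp hj with h | h
      · exact ih2 (fun hx => hin (hl.mpr (Or.inl hx))) j h hjl
      · subst h; exact hin (hl.mpr (Or.inr hjl))

end BMC

open BMC in
/-- Proposition (variable optimisation of the liveness-to-safety
transformation): if every variable in `Vi` is a transition input variable
irrelevant for fairness, then the transformation `M̂` (tracking all variables)
reaches a state with `LoopClosed` true iff the variant `M̃` restricting loop
detection to the variables in `V ∖ Vi` does. -/
theorem l2s_variable_optimisation {V : Type} {R : V → Type} {AP : Type} {f : ℕ}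
    [Finite V] [∀ v, Finite (R v)]
    (M : FairKripke (∀ v, R v) AP f) (hTot : M.toKripke.Total)
    (Vi : Set V)
    (hInput : ∀ v0 ∈ Vi, TransitionInput M v0)
    (hFair : ∀ v0 ∈ Vi, FairnessIrrelevant M v0) :
    (∃ x, L2SReachW M Set.univ x ∧ x.loopClosed) ↔
    (∃ x, L2SReachW M Viᶜ x ∧ x.loopClosed) := by
  classical
  constructor
  · rintro ⟨x, ⟨n, σ, h0, hs, hx⟩, hc⟩
    have hinv : ∀ y : L2SState (∀ v, R v) f, L2SInvW Set.univ y → L2SInvW Viᶜ y :=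
      fun y h => ⟨h.1, fun c w _ => h.2.1 c w trivial, h.2.2⟩
    refine ⟨x, ⟨n, σ, ⟨hinv _ h0.1, h0.2⟩, fun i hi => ?_, hx⟩, hc⟩
    obtain ⟨a, b, c, d, e, g, h, k⟩ := hs i hi
    exact ⟨hinv _ a, hinv _ b, c, d, e, fun l w _ => g l w trivial,
      fun l w _ => h l w trivial, k⟩
  · rintro ⟨x, ⟨n, σ, h0, hs, hx⟩, hc⟩
    subst hx
    have hnpos : n ≠ 0 := by
      rintro rfl
      exact h0.2.2.2.1 (h0.1.1 hc)
    have hI : L2SInvW Viᶜ (σ n) := by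
      obtain ⟨m, rfl⟩ := Nat.exists_eq_succ_of_ne_zero hnpos
      exact (hs m (by omega)).2.1
    obtain ⟨k, hkn, hke, hku⟩ := (l2s_save M Viᶜ n σ h0 hs n le_rfl).1 (hI.1 hc)
    have heq : EqOn Viᶜ (σ k).v (σ n).v :=
      fun w hw => ((hI.2.1 hc w hw).trans (hke w hw)).symm
    have hF : ∀ m, (σ n).v ∈ M.F m ↔ (σ k).v ∈ M.F m := by
      intro m
      have hgen : ∀ v0 ∈ Vi, ∀ y y' : ∀ v, R v, (∀ w, w ≠ v0 → y' w = y w) →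
          y ∈ M.F m → y' ∈ M.F m := fun v0 hv y y' h hy => (hFair v0 hv m y y' h).mp hy
      exact ⟨l2s_inv_of_single Vi (fun y => y ∈ M.F m) hgen _ _ heq,
        l2s_inv_of_single Vi (fun y => y ∈ M.F m) hgen _ _ (fun w hw => (heq w hw).symm)⟩
    let τ : ℕ → L2SState (∀ v, R v) f := fun i =>
      { v := if i = n then (σ k).v else (σ i).v
        vbar := (σ k).v
        ls := (σ i).ls
        inLoop := (σ i).inLoop
        loopClosed := i = n
        acc := (σ i).acc }
    have hτ : ∀ i, L2SInvW Set.univ (τ i) := by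
      intro i
      refine ⟨?_, ?_, ?_⟩
      · intro h
        change i = n at h
        subst h; exact hI.1 hc
      · intro h w _
        change i = n at h
        simp [τ, h]
      · intro m h
        change i = n at h
        subst h; exact hI.2.2 m hc
    refine ⟨τ n, ⟨n, τ, ⟨hτ 0, ?_, h0.2.2⟩, fun i hi => ?_, rfl⟩, rfl⟩
    · simpa [τ, hnpos.symm] using h0.2.1
    · obtain ⟨-, -, c, d, e, -, -, g⟩ := hs i hi
      have hin : i ≠ n := by omega
      refine ⟨hτ _, hτ _, ?_, d, e, ?_, fun _ w _ => rfl, ?_⟩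
      · by_cases h : i + 1 = n
        · simp only [τ, hin, h, if_true, if_false]
          rw [h] at c
          exact l2s_inv_of_single Vi (fun y => M.T (σ i).v y)
            (fun v0 hv y y' hy hT => hInput v0 hv _ y y' hT hy) _ _ heq c
        · simpa [τ, hin, h] using c
      · intro hl w _
        have := hku i hi hl
        subst this
        simp [τ, hin]
      · intro m
        by_cases h : i + 1 = n
        · have := g m
          rw [h, hF m] at this
          simpa [τ, h] using this
        · simpa [τ, h] using g m
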